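/- arXiv:1803.02360 — 2 statements merged into one kernel-verified Lean document; each statement's English description precedes it below -/
import Mathlib

section
/- Let 0 ≤ λ ≤ 1, let p : ℕ → ℝ be a probability distribution on ℕ (p_n ≥ 0, ∑_n p_n = 1) whose Shannon entropy S(p) = −∑_n p_n ln p_n is finite, and let E ≥ 0 be such that g(E) = S(p), where g(E) = (E+1)ln(E+1) − E ln E for E > 0 and g(0) = 0. Then the Shannon entropy of the thinned distribution satisfies S(T_λ(p)) ≥ g(λE), where S(T_λ(p)) = −∑_n (T_λ(p))_n ln (T_λ(p))_n is a well-defined element of [0,∞] since each term is nonnegative. -/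
/-- The thinning with parameter `λ` of a (summable) sequence `x : ℕ → ℝ`:
`(T_λ x)_n = ∑_{k} (k choose n) λ^n (1−λ)^{k−n} x_k` (the binomial coefficient vanishes
for `k < n`, so this is the sum from `k = n`; the convention `0^0 = 1` is Lean's). -/
noncomputable def thin (lam : ℝ) (x : ℕ → ℝ) : ℕ → ℝ :=
  fun n => ∑' k : ℕ, (k.choose n : ℝ) * lam ^ n * (1 - lam) ^ (k - n) * x k

/-- The function `g(E) = (E+1)ln(E+1) − E ln E`, the Shannon entropy of the geometric
distribution with mean `E` (note that `Real.log 0 = 0`, so this formula also gives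
`g(0) = 0`). -/
noncomputable def gfun (E : ℝ) : ℝ := (E + 1) * Real.log (E + 1) - E * Real.log E

open Real Set Filter Topology Finset

lemma one_sub_mul_log_le {u v : ℝ} (hu : 0 < u) (huv : u ≤ v) (hv : v < 1) :
    (1 - v) * log u ≤ (1 - u) * log v := by
  have hu1 : 0 < 1 - u := by linarith
  have h := strictConcaveOn_log_Ioi.concaveOn.2 (mem_Ioi.2 hu) (mem_Ioi.2 one_pos)
    (div_nonneg (by linarith : 0 ≤ 1 - v) hu1.le) (div_nonneg (by linarith : 0 ≤ v - u) hu1.le)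
    (by field_simp; ring)
  have hc : (1 - v) / (1 - u) * u + (v - u) / (1 - u) * 1 = v := by field_simp; ring
  simp only [smul_eq_mul, log_one, mul_zero, add_zero] at h
  rw [hc, div_mul_eq_mul_div, div_le_iff₀ hu1] at h
  linarith

/-- The Bellman inequality for the hazard rates of a distribution, with equality at `r = s`. -/
lemma hazard_inequality {s r : ℝ} (hs0 : 0 < s) (hs1 : s < 1) (hr0 : 0 ≤ r) (hr1 : r < 1) :
    (1 - s) * -(r * log r) + (-log s - (1 - s)) * ((1 - r) * log (1 - r)) ≤
      (s * -log s + (-log s - (1 - s)) * log (1 - s)) * (1 - r) := by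
  set d := -log s - (1 - s) with hd
  let F : ℝ → ℝ := fun t => (1 - s) * negMulLog t / (1 - t) + d * log (1 - t)
  have hcont : ContinuousOn F (Ico 0 1) := by
    have hne : ∀ t ∈ Ico (0 : ℝ) 1, 1 - t ≠ 0 := fun t ht => by linarith [ht.2]
    refine ContinuousOn.add (ContinuousOn.div ?_ (by fun_prop) hne) ?_
    · exact (continuous_const.mul continuous_negMulLog).continuousOn
    · exact continuousOn_const.mul (ContinuousOn.log (by fun_prop) hne)
  have hder : ∀ t ∈ Ioo (0 : ℝ) 1,
      HasDerivAt F (((1 - t) * log s - (1 - s) * log t) / (1 - t) ^ 2) t := by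
    intro t ht
    have h1 : 1 - t ≠ 0 := by linarith [ht.2]
    have hsub : HasDerivAt (fun t : ℝ => 1 - t) (-1) t := by
      simpa using (hasDerivAt_id t).const_sub 1
    have h := (((hasDerivAt_negMulLog ht.1.ne').const_mul (1 - s)).div hsub h1).add
      ((hsub.log h1).const_mul d)
    refine h.congr_deriv ?_
    rw [hd, negMulLog]
    field_simp
    ring
  have hF : F r ≤ F s := by
    rcases le_total r s with h | h
    · have hm : MonotoneOn F (Icc 0 s) := by
        refine monotoneOn_of_deriv_nonneg (convex_Icc _ _)
          (hcont.mono fun t ht => ⟨ht.1, ht.2.trans_lt hs1⟩) ?_ ?_ <;> rw [interior_Icc]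
        · exact fun t ht =>
            (hder t ⟨ht.1, ht.2.trans hs1⟩).differentiableAt.differentiableWithinAt
        · intro t ht
          rw [(hder t ⟨ht.1, ht.2.trans hs1⟩).deriv]
          exact div_nonneg (by linarith [one_sub_mul_log_le ht.1 ht.2.le hs1]) (sq_nonneg _)
      exact hm ⟨hr0, h⟩ ⟨hs0.le, le_rfl⟩ h
    · have hm : AntitoneOn F (Icc s r) := by
        refine antitoneOn_of_deriv_nonpos (convex_Icc _ _)
          (hcont.mono fun t ht => ⟨hs0.le.trans ht.1, ht.2.trans_lt hr1⟩) ?_ ?_ <;>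
          rw [interior_Icc]
        · exact fun t ht => (hder t ⟨hs0.trans ht.1, ht.2.trans hr1⟩).differentiableAt
            |>.differentiableWithinAt
        · intro t ht
          rw [(hder t ⟨hs0.trans ht.1, ht.2.trans hr1⟩).deriv]
          exact div_nonpos_of_nonpos_of_nonneg
            (by linarith [one_sub_mul_log_le hs0 ht.1.le (ht.2.trans hr1)]) (sq_nonneg _)
      exact hm ⟨le_rfl, h⟩ ⟨h, le_rfl⟩ h
  have hr : (0 : ℝ) < 1 - r := by linarith
  have hs : (1 : ℝ) - s ≠ 0 := by linarith
  have hFs : F s = s * -log s + d * log (1 - s) := by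
    simp only [F, negMulLog]
    field_simp
  have hFr : F r * (1 - r) = (1 - s) * -(r * log r) + d * ((1 - r) * log (1 - r)) := by
    simp only [F, negMulLog]
    field_simp
  rw [← hFs, ← hFr]
  exact mul_le_mul_of_nonneg_right hF hr.le

/-- Jensen's inequality for the one-step shift of a finitely supported positive sequence. -/
lemma sum_shift_mul_log_le (N : ℕ) (a : ℕ → ℝ) (ha : ∀ n < N + 1, 0 < a n) (h0 : a (N + 1) = 0) :
    ∑ n ∈ range (N + 1), a (n + 1) * (log (a n) - log (a (n + 1))) ≤
      (∑ n ∈ range N, a (n + 1)) *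
        (log (∑ n ∈ range (N + 1), a n) - log (∑ n ∈ range N, a (n + 1))) := by
  rcases Nat.eq_zero_or_pos N with rfl | hN
  · simp [h0]
  set P := ∑ n ∈ range (N + 1), a n with hP
  set Q := ∑ n ∈ range N, a (n + 1) with hQ
  have hQpos : 0 < Q := sum_pos (fun n hn => ha _ (by simpa using hn)) ⟨0, by simpa using hN⟩
  have hPpos : 0 < P := sum_pos (fun n hn => ha _ (by simpa using hn)) ⟨0, by simp⟩
  have hQ' : ∑ n ∈ range (N + 1), a (n + 1) = Q := by rw [sum_range_succ, h0, add_zero]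
  have key : ∀ n ∈ range (N + 1), a (n + 1) * (log (a n) - log (a (n + 1))) ≤
      a (n + 1) * (log P - log Q) + (a n * (Q / P) - a (n + 1)) := by
    intro n hn
    have hn' : n < N + 1 := by simpa using hn
    have han := ha n hn'
    rcases (Nat.lt_succ_iff.1 hn').lt_or_eq with h | h
    · have hb := ha (n + 1) (by omega)
      have hl := log_le_sub_one_of_pos (x := a n * Q / (a (n + 1) * P)) (by positivity)
      rw [log_div (by positivity) (by positivity), log_mul han.ne' hQpos.ne',
        log_mul hb.ne' hPpos.ne'] at hl
      have := mul_le_mul_of_nonneg_left hl hb.le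
      have e : a (n + 1) * (a n * Q / (a (n + 1) * P) - 1) = a n * (Q / P) - a (n + 1) := by
        field_simp
      rw [e] at this
      linarith
    · subst h
      rw [h0]
      have : 0 ≤ a n * (Q / P) := by positivity
      simpa using this
  refine (sum_le_sum key).trans_eq ?_
  rw [sum_add_distrib, sum_sub_distrib, ← sum_mul, ← sum_mul, hQ', ← hP]
  field_simp
  ring

/-- Isoperimetric inequality in linearized, homogeneous form. -/
lemma isoperimetric_of_hazard {L d K : ℝ} (hL : 0 ≤ L)
    (hK : ∀ r, 0 ≤ r → r < 1 →
      (L - d) * -(r * log r) + d * ((1 - r) * log (1 - r)) ≤ K * (1 - r))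
    (N : ℕ) (a : ℕ → ℝ) (ha : ∀ n < N, 0 < a n) (h0 : a N = 0) :
    L * ∑ n ∈ range N, (n + 1) * (a (n + 1) * (log (a n) - log (a (n + 1)))) +
        d * ∑ n ∈ range N, a n * log (a n) ≤
      K * ∑ n ∈ range N, a n + d * ((∑ n ∈ range N, a n) * log (∑ n ∈ range N, a n)) := by
  induction N generalizing a with
  | zero => simp
  | succ N ih =>
    have ih' := ih (fun n => a (n + 1)) (fun n hn => ha _ (by omega)) h0
    have hJ := mul_le_mul_of_nonneg_left (sum_shift_mul_log_le N a ha h0) hL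
    have e1 : ∑ n ∈ range (N + 1), ((n : ℝ) + 1) * (a (n + 1) * (log (a n) - log (a (n + 1)))) =
        ∑ n ∈ range (N + 1), a (n + 1) * (log (a n) - log (a (n + 1))) +
        ∑ n ∈ range N, ((n : ℝ) + 1) *
          (a (n + 1 + 1) * (log (a (n + 1)) - log (a (n + 1 + 1)))) := by
      have : ∑ n ∈ range (N + 1), ((n : ℝ)) * (a (n + 1) * (log (a n) - log (a (n + 1)))) =
        ∑ n ∈ range N, ((n : ℝ) + 1) *
          (a (n + 1 + 1) * (log (a (n + 1)) - log (a (n + 1 + 1)))) := by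
        rw [sum_range_succ']
        simp
      rw [← this, ← sum_add_distrib]
      exact sum_congr rfl fun n _ => by ring
    have e2 : ∑ n ∈ range (N + 1), a n * log (a n) =
        a 0 * log (a 0) + ∑ n ∈ range N, a (n + 1) * log (a (n + 1)) := by
      rw [sum_range_succ', add_comm]
    have e3 : ∑ n ∈ range (N + 1), a n = a 0 + ∑ n ∈ range N, a (n + 1) := by
      rw [sum_range_succ', add_comm]
    rw [e1, e2, e3]
    rw [e3] at hJ
    have hQ : 0 ≤ ∑ n ∈ range N, a (n + 1) :=
      sum_nonneg fun n hn => (ha _ (by simpa using hn)).le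
    have hA := ha 0 (by omega)
    generalize ∑ n ∈ range N, a (n + 1) = Q at *
    generalize a 0 = A at *
    have hP : 0 < A + Q := by linarith
    have hr := hK (Q / (A + Q)) (by positivity) (by rw [div_lt_one hP]; linarith)
    have h1r : 1 - Q / (A + Q) = A / (A + Q) := by field_simp; ring
    rw [h1r, log_div hA.ne' hP.ne'] at hr
    have hl : Q / (A + Q) * log (Q / (A + Q)) = Q / (A + Q) * (log Q - log (A + Q)) := by
      rcases hQ.eq_or_lt with h | h
      · simp [← h]
      · rw [log_div h.ne' hP.ne']
    rw [hl] at hr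
    have hr' := mul_le_mul_of_nonneg_right hr hP.le
    have e4 : ((L - d) * -(Q / (A + Q) * (log Q - log (A + Q))) +
        d * (A / (A + Q) * (log A - log (A + Q)))) * (A + Q) =
        (L - d) * -(Q * (log Q - log (A + Q))) + d * (A * (log A - log (A + Q))) := by
      field_simp
    have e5 : K * (A / (A + Q)) * (A + Q) = K * A := by field_simp
    rw [e4, e5] at hr'
    linarith

/-- The binomial weight: the probability that `k` particles are thinned to `n`. -/
noncomputable def binomWeight (l : ℝ) (k n : ℕ) : ℝ := k.choose n * l ^ n * (1 - l) ^ (k - n)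

lemma binomWeight_nonneg {l : ℝ} (h0 : 0 ≤ l) (h1 : l ≤ 1) (k n : ℕ) : 0 ≤ binomWeight l k n := by
  have : 0 ≤ 1 - l := by linarith
  unfold binomWeight
  positivity

lemma binomWeight_eq_zero (l : ℝ) {k n : ℕ} (h : k < n) : binomWeight l k n = 0 := by
  simp [binomWeight, Nat.choose_eq_zero_of_lt h]

lemma sum_binomWeight (l : ℝ) (k : ℕ) : ∑ n ∈ range (k + 1), binomWeight l k n = 1 := by
  have h := add_pow l (1 - l) k
  rw [add_sub_cancel, one_pow] at h
  rw [h]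
  exact sum_congr rfl fun n _ => by unfold binomWeight; ring

lemma sum_binomWeight_of_lt (l : ℝ) {k N : ℕ} (hk : k < N) :
    ∑ n ∈ range N, binomWeight l k n = 1 := by
  rw [← sum_binomWeight l k]
  refine (sum_subset (range_mono hk) fun n _ hn => binomWeight_eq_zero l ?_).symm
  simp only [Finset.mem_range] at hn
  omega

lemma binomWeight_le_one {l : ℝ} (h0 : 0 ≤ l) (h1 : l ≤ 1) (k n : ℕ) : binomWeight l k n ≤ 1 := by
  have hk : n ∈ range (max k n + 1) := by simp
  rw [← sum_binomWeight_of_lt l (k := k) (N := max k n + 1) (by omega)]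
  exact single_le_sum (f := fun n => binomWeight l k n)
    (fun i _ => binomWeight_nonneg h0 h1 k i) hk

lemma hasDerivAt_binomWeight {l : ℝ} (hl : l ≠ 0) (k n : ℕ) :
    HasDerivAt (fun t => binomWeight t k n)
      ((n * binomWeight l k n - (n + 1) * binomWeight l k (n + 1)) / l) l := by
  have hsub : HasDerivAt (fun t : ℝ => 1 - t) (-1) l := by
    simpa using (hasDerivAt_id l).const_sub 1
  have h := ((hasDerivAt_pow n l).const_mul (k.choose n : ℝ)).mul (hsub.pow (k - n))
  refine h.congr_deriv ?_
  have hc : (k.choose (n + 1) : ℝ) * (n + 1) = k.choose n * ((k - n : ℕ) : ℝ) := by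
    exact_mod_cast Nat.choose_succ_right_eq k n
  have hn : (n : ℝ) * l ^ (n - 1) * l = n * l ^ n := by
    rcases n with _ | n
    · simp
    · simp [pow_succ]; ring
  have hs : k - (n + 1) = k - n - 1 := by omega
  rw [eq_div_iff hl]
  unfold binomWeight
  rw [hs]
  simp only [Pi.pow_apply]
  linear_combination (k.choose n * (1 - l) ^ (k - n)) * hn +
    (l ^ (n + 1) * (1 - l) ^ (k - n - 1)) * hc

lemma continuous_binomWeight (k n : ℕ) : Continuous fun t => binomWeight t k n := by
  unfold binomWeight
  fun_prop

/-- The thinning of the sequence `a` restricted to `{0, …, N - 1}`. -/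
noncomputable def finThin (N : ℕ) (a : ℕ → ℝ) (n : ℕ) (l : ℝ) : ℝ :=
  ∑ k ∈ range N, binomWeight l k n * a k

lemma finThin_eq_zero {N n : ℕ} (a : ℕ → ℝ) (h : N ≤ n) (l : ℝ) : finThin N a n l = 0 :=
  sum_eq_zero fun k hk => by
    rw [binomWeight_eq_zero l ((Finset.mem_range.1 hk).trans_le h), zero_mul]

lemma sum_finThin (N : ℕ) (a : ℕ → ℝ) (l : ℝ) :
    ∑ n ∈ range N, finThin N a n l = ∑ k ∈ range N, a k := by
  unfold finThin
  rw [sum_comm]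
  refine sum_congr rfl fun k hk => ?_
  rw [← sum_mul, sum_binomWeight_of_lt l (Finset.mem_range.1 hk), one_mul]

lemma finThin_one {N n : ℕ} (a : ℕ → ℝ) (hn : n < N) : finThin N a n 1 = a n := by
  unfold finThin
  rw [sum_eq_single_of_mem n (Finset.mem_range.2 hn)]
  · simp [binomWeight]
  · intro k _ hk
    rcases lt_or_gt_of_ne hk with h | h
    · rw [binomWeight_eq_zero 1 h, zero_mul]
    · have : k - n ≠ 0 := by omega
      simp [binomWeight, this]

lemma finThin_pos {N n : ℕ} {a : ℕ → ℝ} (ha : ∀ k, 0 ≤ a k) (haN : 0 < a N) (hn : n < N + 1)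
    {l : ℝ} (h0 : 0 < l) (h1 : l < 1) : 0 < finThin (N + 1) a n l := by
  refine sum_pos' (fun k _ => mul_nonneg (binomWeight_nonneg h0.le h1.le k n) (ha k))
    ⟨N, by simp, mul_pos ?_ haN⟩
  have : 0 < 1 - l := by linarith
  have : 0 < N.choose n := Nat.choose_pos (by omega)
  unfold binomWeight
  positivity

lemma hasDerivAt_finThin (N : ℕ) (a : ℕ → ℝ) (n : ℕ) {l : ℝ} (hl : l ≠ 0) :
    HasDerivAt (finThin N a n) ((n * finThin N a n l - (n + 1) * finThin N a (n + 1) l) / l) l := by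
  have h : HasDerivAt (fun t => ∑ k ∈ range N, binomWeight t k n * a k) _ l :=
    HasDerivAt.fun_sum fun k _ => (hasDerivAt_binomWeight hl k n).mul_const (a k)
  refine h.congr_deriv ?_
  unfold finThin
  rw [mul_sum, mul_sum, ← sum_sub_distrib, sum_div]
  exact sum_congr rfl fun k _ => by ring

lemma continuous_finThin (N : ℕ) (a : ℕ → ℝ) (n : ℕ) : Continuous (finThin N a n) :=
  continuous_finsetSum _ fun k _ => (continuous_binomWeight k n).mul continuous_const

lemma hasDerivAt_entropy_finThin {N : ℕ} {a : ℕ → ℝ} (ha : ∀ k, 0 ≤ a k) (haN : 0 < a N) {l : ℝ}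
    (h0 : 0 < l) (h1 : l < 1) :
    HasDerivAt (fun t => ∑ n ∈ range (N + 1), negMulLog (finThin (N + 1) a n t))
      ((∑ n ∈ range (N + 1), (n + 1) * (finThin (N + 1) a (n + 1) l *
        (log (finThin (N + 1) a n l) - log (finThin (N + 1) a (n + 1) l)))) / l) l := by
  have h : HasDerivAt (fun t => ∑ n ∈ range (N + 1), negMulLog (finThin (N + 1) a n t)) _ l :=
    HasDerivAt.fun_sum fun n hn =>
      (hasDerivAt_negMulLog (finThin_pos ha haN (Finset.mem_range.1 hn) h0 h1).ne').comp l
        (hasDerivAt_finThin (N + 1) a n h0.ne')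
  refine h.congr_deriv ?_
  have hz : finThin (N + 1) a (N + 1) l = 0 := finThin_eq_zero a le_rfl l
  set q := fun n => finThin (N + 1) a n l with hq
  change ∑ n ∈ range (N + 1), (-log (q n) - 1) * ((n * q n - (n + 1) * q (n + 1)) / l) =
    (∑ n ∈ range (N + 1), (n + 1) * (q (n + 1) * (log (q n) - log (q (n + 1))))) / l
  have ht := sum_range_sub (fun n : ℕ => (n : ℝ) * q n * (log (q n) + 1)) (N + 1)
  have hz' : q (N + 1) = 0 := hz
  rw [hz'] at ht
  simp only [Nat.cast_zero, zero_mul, mul_zero, sub_zero] at ht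
  rw [sum_div, ← sub_eq_zero, ← sum_sub_distrib]
  have : ∀ n ∈ range (N + 1), (-log (q n) - 1) * ((n * q n - (n + 1) * q (n + 1)) / l) -
      (n + 1) * (q (n + 1) * (log (q n) - log (q (n + 1)))) / l =
      (((n + 1 : ℕ) : ℝ) * q (n + 1) * (log (q (n + 1)) + 1) - n * q n * (log (q n) + 1)) / l := by
    intro n _
    push_cast
    field_simp
    ring
  rw [sum_congr rfl this, ← sum_div, ht, zero_div]

/-- The derivative of the output entropy is bounded by its value at the geometric distribution. -/
lemma isoperimetric_inequality {x : ℝ} (hx : 0 < x) (N : ℕ) (a : ℕ → ℝ) (ha : ∀ n < N, 0 < a n)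
    (h0 : a N = 0) (h1 : ∑ n ∈ range N, a n = 1) :
    (log (x + 1) - log x) *
        ∑ n ∈ range N, (n + 1) * (a (n + 1) * (log (a n) - log (a (n + 1)))) -
        x * (log (x + 1) - log x) ^ 2 ≤
      (∑ n ∈ range N, negMulLog (a n) - gfun x) * (log (x + 1) - log x - 1 / (x + 1)) := by
  have hx1 : 0 < x + 1 := by linarith
  have hs0 : 0 < x / (x + 1) := by positivity
  have hs1 : x / (x + 1) < 1 := by rw [div_lt_one hx1]; linarith
  have hs : 1 - x / (x + 1) = 1 / (x + 1) := by field_simp; ring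
  have hL : -log (x / (x + 1)) = log (x + 1) - log x := by
    rw [log_div hx.ne' hx1.ne']; ring
  have hlog : log (1 / (x + 1)) = -log (x + 1) := by rw [one_div, log_inv]
  have hLpos : 0 ≤ log (x + 1) - log x := by
    linarith [log_le_log hx (by linarith : x ≤ x + 1)]
  have h := isoperimetric_of_hazard hLpos (d := log (x + 1) - log x - 1 / (x + 1))
    (K := x / (x + 1) * (log (x + 1) - log x) +
      (log (x + 1) - log x - 1 / (x + 1)) * -log (x + 1)) (fun r hr0 hr1 => by
      have := hazard_inequality hs0 hs1 hr0 hr1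
      rw [hs, hL, hlog] at this
      simpa using this) N a ha h0
  rw [h1] at h
  simp only [negMulLog, neg_mul, sum_neg_distrib, gfun]
  have e : x * (log (x + 1) - log x) ^ 2 - ((x + 1) * log (x + 1) - x * log x) *
      (log (x + 1) - log x - 1 / (x + 1)) = x / (x + 1) * (log (x + 1) - log x) +
      (log (x + 1) - log x - 1 / (x + 1)) * -log (x + 1) := by
    field_simp
    ring
  simp only [log_one, mul_zero, add_zero, mul_one] at h
  linarith

lemma hasDerivAt_gfun {x : ℝ} (hx : 0 < x) : HasDerivAt gfun (log (x + 1) - log x) x := by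
  have hx1 : x + 1 ≠ 0 := by linarith
  have h1 : HasDerivAt (fun t : ℝ => t + 1) 1 x := (hasDerivAt_id x).add_const 1
  have h := (h1.mul (h1.log hx1)).sub ((hasDerivAt_id x).mul (hasDerivAt_log hx.ne'))
  refine h.congr_deriv ?_
  simp only [id]
  field_simp
  ring

lemma continuous_gfun : Continuous gfun := by
  have h := continuous_mul_log
  exact (h.comp (continuous_id.add continuous_const)).sub h

lemma strictMonoOn_gfun : StrictMonoOn gfun (Ici 0) := by
  refine strictMonoOn_of_deriv_pos (convex_Ici 0) continuous_gfun.continuousOn fun x hx => ?_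
  rw [interior_Ici] at hx
  rw [(hasDerivAt_gfun hx).deriv]
  linarith [log_lt_log hx (by linarith : x < x + 1)]

lemma gfun_zero : gfun 0 = 0 := by simp [gfun]

lemma gfun_le_entropy_finThin_of_pos {N : ℕ} {a : ℕ → ℝ} (ha : ∀ k, 0 ≤ a k) (haN : 0 < a N)
    (hsum : ∑ k ∈ range (N + 1), a k = 1) {E : ℝ} (hE : 0 < E)
    (hS : gfun E ≤ ∑ n ∈ range (N + 1), negMulLog (a n)) {l : ℝ} (h0 : 0 < l) (h1 : l ≤ 1) :
    gfun (l * E) ≤ ∑ n ∈ range (N + 1), negMulLog (finThin (N + 1) a n l) := by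
  let S : ℝ → ℝ := fun t => ∑ n ∈ range (N + 1), negMulLog (finThin (N + 1) a n t)
  let W : ℝ → ℝ := fun t => t * (log (t * E + 1) - log (t * E))
  have hW : ∀ t, 0 < t → 0 < W t := fun t ht => by
    have hx : 0 < t * E := by positivity
    exact mul_pos ht (by linarith [log_lt_log hx (by linarith : t * E < t * E + 1)])
  have hcS : Continuous S := continuous_finsetSum _ fun n _ =>
    continuous_negMulLog.comp (continuous_finThin (N + 1) a n)
  have hanti : AntitoneOn (fun t => (S t - gfun (t * E)) / W t) (Icc l 1) := by
    have hder : ∀ t ∈ Ioo l 1, ∃ D ≤ 0,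
        HasDerivAt (fun t => (S t - gfun (t * E)) / W t) D t := by
      intro t ht
      have ht0 : 0 < t := h0.trans ht.1
      have hx : 0 < t * E := by positivity
      have hx1 : t * E + 1 ≠ 0 := by positivity
      have hmul : HasDerivAt (fun t : ℝ => t * E) E t := by
        simpa using (hasDerivAt_id t).mul_const E
      have hdS := hasDerivAt_entropy_finThin ha haN ht0 ht.2
      have hdg : HasDerivAt (fun t => gfun (t * E)) ((log (t * E + 1) - log (t * E)) * E) t :=
        HasDerivAt.comp (h₂ := gfun) t (hasDerivAt_gfun hx) hmul
      have hdW : HasDerivAt W _ t :=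
        (hasDerivAt_id t).mul (((hmul.add_const 1).log hx1).sub (hmul.log hx.ne'))
      refine ⟨_, ?_, (hdS.sub hdg).div hdW (hW t ht0).ne'⟩
      refine div_nonpos_of_nonpos_of_nonneg ?_ (sq_nonneg _)
      have hiso := isoperimetric_inequality hx (N + 1) (fun n => finThin (N + 1) a n t)
        (fun n hn => finThin_pos ha haN hn ht0 ht.2) (finThin_eq_zero a le_rfl t)
        (by rw [sum_finThin, hsum])
      rw [← sub_nonpos] at hiso
      refine (le_of_eq ?_).trans hiso
      simp only [W, id, Pi.sub_apply]
      field_simp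
      ring
    refine antitoneOn_of_deriv_nonpos (convex_Icc _ _) ?_ ?_ ?_
    · refine ContinuousOn.div (hcS.sub (continuous_gfun.comp
        (continuous_id.mul continuous_const))).continuousOn ?_
        fun t ht => (hW t (h0.trans_le ht.1)).ne'
      refine continuousOn_id.mul (ContinuousOn.sub (ContinuousOn.log (by fun_prop) ?_)
        (ContinuousOn.log (by fun_prop) ?_)) <;> intro t ht
      · have := h0.trans_le ht.1
        positivity
      · have := h0.trans_le ht.1
        positivity
    · rw [interior_Icc]
      intro t ht
      obtain ⟨D, -, hD⟩ := hder t ht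
      exact hD.differentiableAt.differentiableWithinAt
    · rw [interior_Icc]
      intro t ht
      obtain ⟨D, hD0, hD⟩ := hder t ht
      rwa [hD.deriv]
  have hle := hanti ⟨le_rfl, h1⟩ ⟨h1, le_rfl⟩ h1
  have hS1 : S 1 = ∑ n ∈ range (N + 1), negMulLog (a n) :=
    sum_congr rfl fun n hn => by rw [finThin_one a (Finset.mem_range.1 hn)]
  have hpos : 0 ≤ (S 1 - gfun (1 * E)) / W 1 :=
    div_nonneg (by rw [hS1, one_mul]; linarith) (hW 1 one_pos).le
  have h := mul_nonneg (hpos.trans hle) (hW l h0).le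
  rw [div_mul_cancel₀ _ (hW l h0).ne'] at h
  exact sub_nonneg.1 h

lemma gfun_le_entropy_finThin {N : ℕ} {a : ℕ → ℝ} (ha : ∀ k, 0 ≤ a k)
    (hsum : ∑ k ∈ range N, a k = 1) {E : ℝ} (hE : 0 < E)
    (hS : gfun E ≤ ∑ n ∈ range N, negMulLog (a n)) {l : ℝ} (h0 : 0 < l) (h1 : l ≤ 1) :
    gfun (l * E) ≤ ∑ n ∈ range N, negMulLog (finThin N a n l) := by
  induction N with
  | zero => simp at hsum
  | succ N ih =>
    rcases (ha N).eq_or_lt with h | h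
    · have hf : ∀ n, finThin (N + 1) a n l = finThin N a n l := fun n => by
        unfold finThin
        rw [sum_range_succ, ← h, mul_zero, add_zero]
      rw [sum_range_succ, ← h, add_zero] at hsum
      rw [sum_range_succ, ← h, negMulLog_zero, add_zero] at hS
      rw [sum_range_succ]
      simp only [hf, finThin_eq_zero a le_rfl l, negMulLog_zero, add_zero]
      exact ih hsum hS
    · exact gfun_le_entropy_finThin_of_pos ha h hsum hE hS h0 h1

lemma mul_negMulLog_le {Z u w : ℝ} (hZ : 0 < Z) (hZ1 : Z ≤ 1) (hu : 0 ≤ u) (hw : 0 ≤ w)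
    (hwZ : w ≤ 1 - Z) : Z * negMulLog u ≤ negMulLog (Z * u + w) := by
  rcases hZ1.eq_or_lt with rfl | h
  · have : w = 0 := by linarith
    simp [this]
  · have h1 : 0 < 1 - Z := by linarith
    have hv : 0 ≤ w / (1 - Z) := by positivity
    have hc := concaveOn_negMulLog.2 (mem_Ici.2 hu) (mem_Ici.2 hv) hZ.le h1.le (by ring)
    have hn : 0 ≤ negMulLog (w / (1 - Z)) := negMulLog_nonneg hv ((div_le_one h1).2 hwZ)
    simp only [smul_eq_mul, mul_div_cancel₀ w h1.ne'] at hc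
    nlinarith

lemma entropy_normalize {N : ℕ} (p : ℕ → ℝ) {Z : ℝ} (hZ : 0 < Z) (h : ∑ n ∈ range N, p n = Z) :
    ∑ n ∈ range N, negMulLog (p n / Z) = (∑ n ∈ range N, negMulLog (p n)) / Z + log Z := by
  have : ∀ n ∈ range N, negMulLog (p n / Z) = negMulLog (p n) / Z + p n / Z * log Z := by
    intro n _
    by_cases hp : p n = 0
    · simp [hp]
    · rw [negMulLog, log_div hp hZ.ne', negMulLog]
      ring
  rw [sum_congr rfl this, sum_add_distrib, ← sum_div, ← sum_mul, ← sum_div, h,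
    div_self hZ.ne', one_mul]

lemma summable_binomWeight_mul {l : ℝ} (h0 : 0 ≤ l) (h1 : l ≤ 1) {p : ℕ → ℝ} (hp : ∀ n, 0 ≤ p n)
    (hs : Summable p) (n : ℕ) : Summable fun k => binomWeight l k n * p k :=
  hs.of_nonneg_of_le (fun k => mul_nonneg (binomWeight_nonneg h0 h1 k n) (hp k))
    fun k => mul_le_of_le_one_left (hp k) (binomWeight_le_one h0 h1 k n)

/-- Concavity of entropy, applied to a distribution and its truncation to `{0, …, N - 1}`. -/
lemma mul_negMulLog_finThin_le {l : ℝ} (h0 : 0 ≤ l) (h1 : l ≤ 1) {p : ℕ → ℝ} (hp : ∀ n, 0 ≤ p n)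
    (hs : HasSum p 1) {N : ℕ} {Z : ℝ} (hZ : 0 < Z) (h : ∑ n ∈ range N, p n = Z) (n : ℕ) :
    Z * negMulLog (finThin N (fun k => p k / Z) n l) ≤ negMulLog (thin l p n) := by
  have hsum := summable_binomWeight_mul h0 h1 hp hs.summable n
  have ht : thin l p n = Z * finThin N (fun k => p k / Z) n l +
      ∑' k, binomWeight l (k + N) n * p (k + N) := by
    have e : Z * finThin N (fun k => p k / Z) n l = ∑ k ∈ range N, binomWeight l k n * p k := by
      unfold finThin
      rw [mul_sum]
      exact sum_congr rfl fun k _ => by field_simp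
    rw [e, hsum.sum_add_tsum_nat_add N]
    rfl
  have htail : Z + ∑' k, p (k + N) = 1 := by
    rw [← h, hs.summable.sum_add_tsum_nat_add N, hs.tsum_eq]
  rw [ht]
  refine mul_negMulLog_le hZ ?_ ?_ ?_ ?_
  · have : 0 ≤ ∑' k, p (k + N) := tsum_nonneg fun k => hp (k + N)
    linarith
  · exact sum_nonneg fun k _ => mul_nonneg (binomWeight_nonneg h0 h1 k n)
      (div_nonneg (hp k) hZ.le)
  · exact tsum_nonneg fun k => mul_nonneg (binomWeight_nonneg h0 h1 _ n) (hp _)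
  · have : ∑' k, binomWeight l (k + N) n * p (k + N) ≤ ∑' k, p (k + N) :=
      Summable.tsum_le_tsum
        (fun k => mul_le_of_le_one_left (hp _) (binomWeight_le_one h0 h1 _ n))
        ((summable_nat_add_iff N).2 hsum) ((summable_nat_add_iff N).2 hs.summable)
    linarith

/-- Geometric distributions minimize the output Shannon entropy of the thinning among all
input probability distributions with a given Shannon entropy: if `p` is a probability
distribution on `ℕ` with finite Shannon entropy `S(p) = −∑ p_n ln p_n = g(E)` for some
`E ≥ 0`, then `S(T_λ(p)) ≥ g(λE)`, where `S(T_λ(p)) ∈ [0,∞]` is the sum of the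
nonnegative terms `−(T_λ(p))_n ln (T_λ(p))_n` in the extended nonnegative reals. -/
theorem thinning_entropy_lower_bound (lam : ℝ) (hlam0 : 0 ≤ lam) (hlam1 : lam ≤ 1)
    (p : ℕ → ℝ) (hp : ∀ n, 0 ≤ p n) (hpsum : HasSum p 1)
    (hent : Summable fun n => p n * Real.log (p n))
    (E : ℝ) (hE : 0 ≤ E) (hgE : gfun E = -∑' n, p n * Real.log (p n)) :
    ENNReal.ofReal (gfun (lam * E)) ≤
      ∑' n, ENNReal.ofReal (-(thin lam p n * Real.log (thin lam p n))) := by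
  rcases hlam0.eq_or_lt with rfl | hl
  · simp [gfun_zero]
  rcases hE.eq_or_lt with rfl | hEpos
  · simp [gfun_zero]
  have hZlim : Tendsto (fun N => ∑ n ∈ range N, p n) atTop (𝓝 1) := hpsum.tendsto_sum_nat
  have hSlim : Tendsto (fun N => ∑ n ∈ range N, negMulLog (p n)) atTop (𝓝 (gfun E)) := by
    have h := hent.hasSum.tendsto_sum_nat.neg
    rw [← hgE] at h
    simpa only [negMulLog, neg_mul, sum_neg_distrib] using h
  have hlim : Tendsto (fun N => (∑ n ∈ range N, negMulLog (p n)) / (∑ n ∈ range N, p n) +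
      log (∑ n ∈ range N, p n)) atTop (𝓝 (gfun E)) := by
    simpa using (hSlim.div hZlim one_ne_zero).add (hZlim.log one_ne_zero)
  have hbelow : ∀ E' ∈ Ioo 0 E, ENNReal.ofReal (gfun (lam * E')) ≤
      ∑' n, ENNReal.ofReal (negMulLog (thin lam p n)) := by
    intro E' hE'
    have hlt : gfun E' < gfun E := strictMonoOn_gfun hE'.1.le hE hE'.2
    have hconv : Tendsto (fun N => ENNReal.ofReal ((∑ n ∈ range N, p n) * gfun (lam * E'))) atTop
        (𝓝 (ENNReal.ofReal (gfun (lam * E')))) := by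
      simpa using ENNReal.tendsto_ofReal (hZlim.mul_const (gfun (lam * E')))
    refine le_of_tendsto hconv ?_
    filter_upwards [hlim.eventually_const_lt hlt, hZlim.eventually_const_lt one_pos] with N hN hZ
    rw [← entropy_normalize p hZ rfl] at hN
    have hfin := gfun_le_entropy_finThin (a := fun k => p k / ∑ n ∈ range N, p n)
      (fun k => div_nonneg (hp k) hZ.le) (by rw [← sum_div, div_self hZ.ne']) hE'.1 hN.le hl hlam1
    calc ENNReal.ofReal ((∑ n ∈ range N, p n) * gfun (lam * E'))
        ≤ ENNReal.ofReal (∑ n ∈ range N, (∑ n ∈ range N, p n) *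
            negMulLog (finThin N (fun k => p k / ∑ n ∈ range N, p n) n lam)) := by
          rw [← mul_sum]
          exact ENNReal.ofReal_le_ofReal (mul_le_mul_of_nonneg_left hfin hZ.le)
      _ ≤ ∑ n ∈ range N, ENNReal.ofReal ((∑ n ∈ range N, p n) *
            negMulLog (finThin N (fun k => p k / ∑ n ∈ range N, p n) n lam)) :=
          le_sum_of_subadditive _ ENNReal.ofReal_zero.le (fun _ _ => ENNReal.ofReal_add_le) _ _
      _ ≤ ∑ n ∈ range N, ENNReal.ofReal (negMulLog (thin lam p n)) :=
          sum_le_sum fun n _ => ENNReal.ofReal_le_ofReal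
            (mul_negMulLog_finThin_le hlam0 hlam1 hp hpsum hZ rfl n)
      _ ≤ _ := ENNReal.sum_le_tsum _
  have hcont : Tendsto (fun E' => ENNReal.ofReal (gfun (lam * E'))) (𝓝[<] E)
      (𝓝 (ENNReal.ofReal (gfun (lam * E)))) :=
    (ENNReal.continuous_ofReal.comp (continuous_gfun.comp
      (continuous_const.mul continuous_id))).continuousAt.tendsto.mono_left nhdsWithin_le_nhds
  simp only [← neg_mul]
  exact le_of_tendsto hcont (by
    filter_upwards [Ioo_mem_nhdsLT hEpos] with E' hE' using hbelow E' hE')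
end

section
/- Norms of the thinning are achieved by geometric distributions: let 0 ≤ λ ≤ 1 and p, q ∈ [1,∞). Then the supremum of ‖T_λ(x)‖_q/‖x‖_p over all x : ℕ → ℝ with 0 < ‖x‖_p < ∞ for which the series defining (T_λ(|x|))_n converges for every n, equals the supremum over E ≥ 0 of ‖T_λ(ω(E))‖_q/‖ω(E)‖_p, as an equality in [0,∞]. -/
open scoped ENNReal

/-- The series defining the thinning of `|x|` converges (absolutely) at every `n`. -/
def ThinSummable (lam : ℝ) (x : ℕ → ℝ) : Prop :=
  ∀ n, Summable fun k : ℕ => (k.choose n : ℝ) * lam ^ n * (1 - lam) ^ (k - n) * |x k|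

/-- The `ℓ^s` norm of a sequence, valued in `[0,∞]`. -/
noncomputable def lnorm (s : ℝ) (x : ℕ → ℝ) : ℝ≥0∞ :=
  (∑' n, ENNReal.ofReal (|x n| ^ s)) ^ (1 / s)

/-- The geometric probability distribution on `ℕ` with mean `E`:
`ω(E)_n = (1/(E+1)) (E/(E+1))^n`. -/
noncomputable def geom (E : ℝ) : ℕ → ℝ := fun n => (1 / (E + 1)) * (E / (E + 1)) ^ n

/-- The `ℓ^s` norm of a sequence of extended nonnegative reals. -/
noncomputable def ennLpNorm (s : ℝ) (f : ℕ → ℝ≥0∞) : ℝ≥0∞ := (∑' n, f n ^ s) ^ (1 / s)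

/-- The kernel `(k choose n) l^n m^(k-n)` of the thinning. -/
noncomputable def binomKernel (l m : ℝ≥0∞) (n k : ℕ) : ℝ≥0∞ :=
  (k.choose n : ℝ≥0∞) * l ^ n * m ^ (k - n)

/-- The thinning of a sequence of extended nonnegative reals. -/
noncomputable def ennThin (l m : ℝ≥0∞) (f : ℕ → ℝ≥0∞) (n : ℕ) : ℝ≥0∞ :=
  ∑' k, binomKernel l m n k * f k

theorem binomKernel_zero_succ (l m : ℝ≥0∞) (k : ℕ) :
    binomKernel l m 0 (k + 1) = m * binomKernel l m 0 k := by
  simp [binomKernel, pow_succ, mul_comm]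

theorem binomKernel_succ_zero (l m : ℝ≥0∞) (n : ℕ) : binomKernel l m (n + 1) 0 = 0 := by
  simp [binomKernel]

theorem binomKernel_succ_succ (l m : ℝ≥0∞) (n k : ℕ) :
    binomKernel l m (n + 1) (k + 1) = m * binomKernel l m (n + 1) k + l * binomKernel l m n k := by
  simp only [binomKernel, Nat.choose_succ_succ, Nat.add_sub_add_right]
  rcases lt_or_ge k (n + 1) with h | h
  · rw [Nat.choose_eq_zero_of_lt h]
    push_cast
    ring
  · obtain ⟨d, rfl⟩ := Nat.exists_eq_add_of_le h
    rw [show n + 1 + d - n = d + 1 by omega, show n + 1 + d - (n + 1) = d by omega]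
    push_cast
    ring

theorem ennThin_zero (l m : ℝ≥0∞) (f : ℕ → ℝ≥0∞) :
    ennThin l m f 0 = m * ennThin l m (fun k => f (k + 1)) 0 + f 0 := by
  rw [ennThin, tsum_eq_zero_add' ENNReal.summable, ennThin, ← ENNReal.tsum_mul_left, add_comm]
  congr 1
  · exact tsum_congr fun k => by rw [binomKernel_zero_succ, mul_assoc]
  · simp [binomKernel]

theorem ennThin_succ (l m : ℝ≥0∞) (f : ℕ → ℝ≥0∞) (n : ℕ) :
    ennThin l m f (n + 1) =
      m * ennThin l m (fun k => f (k + 1)) (n + 1) + l * ennThin l m (fun k => f (k + 1)) n := by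
  rw [ennThin, tsum_eq_zero_add' ENNReal.summable, ennThin, ennThin, ← ENNReal.tsum_mul_left,
    ← ENNReal.tsum_mul_left, ← ENNReal.tsum_add, binomKernel_succ_zero, zero_mul, zero_add]
  exact tsum_congr fun k => by rw [binomKernel_succ_succ]; ring

theorem ennLpNorm_add_le {s : ℝ} (hs : 1 ≤ s) (f g : ℕ → ℝ≥0∞) :
    ennLpNorm s (fun n => f n + g n) ≤ ennLpNorm s f + ennLpNorm s g := by
  simpa [MeasureTheory.lintegral_count, ennLpNorm] using
    ENNReal.lintegral_Lp_add_le (μ := MeasureTheory.Measure.count) (f := f) (g := g)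
      (Measurable.of_discrete.aemeasurable) (Measurable.of_discrete.aemeasurable) hs

theorem ennLpNorm_rpow {s : ℝ} (hs : 0 < s) (f : ℕ → ℝ≥0∞) :
    ennLpNorm s f ^ s = ∑' n, f n ^ s := by
  rw [ennLpNorm, ← ENNReal.rpow_mul, one_div_mul_cancel hs.ne', ENNReal.rpow_one]

theorem ennLpNorm_const_mul {s : ℝ} (hs : 0 < s) (c : ℝ≥0∞) (f : ℕ → ℝ≥0∞) :
    ennLpNorm s (fun n => c * f n) = c * ennLpNorm s f := by
  simp only [ennLpNorm, ENNReal.mul_rpow_of_nonneg _ _ hs.le, ENNReal.tsum_mul_left]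
  rw [ENNReal.mul_rpow_of_nonneg _ _ (by positivity), ← ENNReal.rpow_mul,
    mul_one_div_cancel hs.ne', ENNReal.rpow_one]

theorem ennLpNorm_mono {s : ℝ} (hs : 0 < s) {f g : ℕ → ℝ≥0∞} (h : ∀ n, f n ≤ g n) :
    ennLpNorm s f ≤ ennLpNorm s g :=
  ENNReal.rpow_le_rpow (ENNReal.tsum_le_tsum fun n => ENNReal.rpow_le_rpow (h n) hs.le)
    (by positivity)

/-- Splitting off the first entry of a sequence relates its thinning to that of its tail. -/
theorem ennLpNorm_ennThin_le {q : ℝ} (hq : 1 ≤ q) (l m : ℝ≥0∞) (f : ℕ → ℝ≥0∞) :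
    ennLpNorm q (ennThin l m f) ≤ m * ennLpNorm q (ennThin l m fun k => f (k + 1)) +
      (f 0 ^ q + (l * ennLpNorm q (ennThin l m fun k => f (k + 1))) ^ q) ^ (1 / q) := by
  have hq0 : 0 < q := by linarith
  set y := ennThin l m fun k => f (k + 1)
  let z : ℕ → ℝ≥0∞ := fun n => n.casesOn (f 0) fun n => l * y n
  have hz : ennLpNorm q z = (f 0 ^ q + (l * ennLpNorm q y) ^ q) ^ (1 / q) := by
    rw [ennLpNorm, tsum_eq_zero_add' ENNReal.summable, ← ennLpNorm_const_mul hq0,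
      ennLpNorm_rpow hq0]
    rfl
  have hT : ennThin l m f = fun n => m * y n + z n := by
    funext n
    cases n with
    | zero => exact ennThin_zero l m f
    | succ n => exact ennThin_succ l m f n
  rw [hT, ← hz, ← ennLpNorm_const_mul hq0]
  exact ennLpNorm_add_le hq _ _

theorem ennLpNorm_ennThin_le_of_finite {p q : ℝ} (hp : 1 ≤ p) (hq : 1 ≤ q) {l m C : ℝ≥0∞}
    (h : ∀ a b c : ℝ≥0∞, a ^ p + b ^ p = c ^ p →
      m * (C * b) + (a ^ q + (l * (C * b)) ^ q) ^ (1 / q) ≤ C * c)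
    (N : ℕ) (f : ℕ → ℝ≥0∞) (hf : ∀ k, N ≤ k → f k = 0) :
    ennLpNorm q (ennThin l m f) ≤ C * ennLpNorm p f := by
  have hp0 : 0 < p := by linarith
  have hq0 : 0 < q := by linarith
  induction N generalizing f with
  | zero =>
    have : ennThin l m f = fun _ => 0 := by
      funext n
      simp [ennThin, hf]
    simp [this, ennLpNorm, hq0]
  | succ N ih =>
    have ih := ih (fun k => f (k + 1)) fun k hk => hf _ (by omega)
    refine le_trans (ennLpNorm_ennThin_le hq l m f) (le_trans ?_ (h (f 0) (ennLpNorm p fun k => f (k + 1)) _ ?_))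
    · gcongr
    · rw [ennLpNorm_rpow hp0, ennLpNorm_rpow hp0, tsum_eq_zero_add' (f := fun n => f n ^ p)
        ENNReal.summable]

theorem ennLpNorm_ennThin_le_mul {p q : ℝ} (hp : 1 ≤ p) (hq : 1 ≤ q) {l m C : ℝ≥0∞}
    (h : ∀ a b c : ℝ≥0∞, a ^ p + b ^ p = c ^ p →
      m * (C * b) + (a ^ q + (l * (C * b)) ^ q) ^ (1 / q) ≤ C * c)
    (f : ℕ → ℝ≥0∞) :
    ennLpNorm q (ennThin l m f) ≤ C * ennLpNorm p f := by
  have hp0 : 0 < p := by linarith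
  have hq0 : 0 < q := by linarith
  rw [← ENNReal.rpow_le_rpow_iff hq0, ennLpNorm_rpow hq0]
  refine ENNReal.tsum_le_of_sum_range_le fun M => ?_
  have hlim : Filter.Tendsto
      (fun N => ∑ n ∈ Finset.range M, (∑ k ∈ Finset.range N, binomKernel l m n k * f k) ^ q)
      Filter.atTop (nhds (∑ n ∈ Finset.range M, ennThin l m f n ^ q)) :=
    tendsto_finsetSum _ fun n _ =>
      (ENNReal.continuous_rpow_const.tendsto _).comp (ENNReal.tendsto_nat_tsum _)
  refine le_of_tendsto' hlim fun N => ?_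
  let g : ℕ → ℝ≥0∞ := fun k => if k < N then f k else 0
  have hg : ∀ n, ennThin l m g n = ∑ k ∈ Finset.range N, binomKernel l m n k * f k := by
    intro n
    rw [ennThin, tsum_eq_sum (s := Finset.range N)]
    · exact Finset.sum_congr rfl fun k hk => by simp [g, Finset.mem_range.1 hk]
    · intro k hk
      simp [g, Finset.mem_range.not.1 hk]
  calc ∑ n ∈ Finset.range M, (∑ k ∈ Finset.range N, binomKernel l m n k * f k) ^ q
      = ∑ n ∈ Finset.range M, ennThin l m g n ^ q := by simp only [hg]
    _ ≤ ∑' n, ennThin l m g n ^ q := ENNReal.sum_le_tsum _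
    _ = ennLpNorm q (ennThin l m g) ^ q := (ennLpNorm_rpow hq0 _).symm
    _ ≤ (C * ennLpNorm p f) ^ q := by
        gcongr
        refine (ennLpNorm_ennThin_le_of_finite hp hq h N g fun k hk => ?_).trans ?_
        · simp [g, not_lt.2 hk]
        · gcongr
          refine ennLpNorm_mono hp0 fun n => ?_
          by_cases hn : n < N <;> simp [g, hn]

theorem lnorm_eq_ennLpNorm {s : ℝ} (hs : 0 ≤ s) (x : ℕ → ℝ) :
    lnorm s x = ennLpNorm s fun n => ‖x n‖ₑ := by
  simp only [lnorm, ennLpNorm, Real.enorm_eq_ofReal_abs]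
  simp only [ENNReal.ofReal_rpow_of_nonneg (abs_nonneg _) hs]

theorem enorm_thin_le (lam : ℝ) (x : ℕ → ℝ) (n : ℕ) :
    ‖thin lam x n‖ₑ ≤ ennThin ‖lam‖ₑ ‖1 - lam‖ₑ (fun k => ‖x k‖ₑ) n := by
  refine enorm_tsum_le_tsum_enorm.trans_eq (tsum_congr fun k => ?_)
  rw [enorm_mul, enorm_mul, enorm_mul, enorm_pow, enorm_pow, binomKernel,
    Real.enorm_of_nonneg (Nat.cast_nonneg _), ENNReal.ofReal_natCast]

theorem rpow_sub_rpow_pos {s E : ℝ} (hs : 1 ≤ s) (hE : 0 ≤ E) : 0 < (E + 1) ^ s - E ^ s :=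
  sub_pos.2 (Real.rpow_lt_rpow hE (by linarith) (by linarith))

/-- One step of the recursion, for a constant that is valid for geometric sequences. -/
theorem thinning_step_le {lam p q C a b c : ℝ} (hlam0 : 0 ≤ lam) (hp : 1 ≤ p) (hq : 1 ≤ q)
    (hC0 : 0 ≤ C) (ha : 0 ≤ a) (hb : 0 ≤ b) (hc : 0 ≤ c) (habc : a ^ p + b ^ p = c ^ p)
    (hC : ∀ E : ℝ, 0 ≤ E → ((E + 1) ^ p - E ^ p) ^ (1 / p) ≤
      C * ((lam * E + 1) ^ q - (lam * E) ^ q) ^ (1 / q)) :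
    (1 - lam) * (C * b) + (a ^ q + (lam * (C * b)) ^ q) ^ (1 / q) ≤ C * c := by
  have hp0 : 0 < p := by linarith
  have hq0 : 0 < q := by linarith
  have hbc : b ≤ c := by
    rw [← Real.rpow_le_rpow_iff hb hc hp0]
    linarith [Real.rpow_nonneg ha p]
  rcases hbc.eq_or_lt with rfl | hlt
  · have ha0 : a = 0 := by
      have : a ^ p = 0 := by linarith
      exact (Real.rpow_eq_zero ha hp0.ne').1 this
    rw [ha0, Real.zero_rpow hq0.ne', zero_add, ← Real.rpow_mul (by positivity),
      mul_one_div_cancel hq0.ne', Real.rpow_one]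
    linarith
  · obtain ⟨t, ht⟩ : ∃ t, t = c - b := ⟨_, rfl⟩
    have ht0 : 0 < t := by linarith
    obtain ⟨E, hE⟩ : ∃ E, E = b / t := ⟨_, rfl⟩
    have hE0 : 0 ≤ E := by rw [hE]; positivity
    have hb' : b = t * E := by rw [hE]; field_simp
    have hc' : c = t * (E + 1) := by linarith
    have hV : 0 ≤ lam * E := by positivity
    have hA := rpow_sub_rpow_pos hp hE0
    have hG := rpow_sub_rpow_pos hq hV
    have haA : a = t * ((E + 1) ^ p - E ^ p) ^ (1 / p) := by
      have h1 : a ^ p = t ^ p * ((E + 1) ^ p - E ^ p) := by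
        rw [mul_sub, ← Real.mul_rpow ht0.le (by positivity), ← Real.mul_rpow ht0.le hE0,
          ← hb', ← hc']
        linarith
      have h2 : a = (a ^ p) ^ (1 / p) := by
        rw [← Real.rpow_mul ha, mul_one_div_cancel hp0.ne', Real.rpow_one]
      rw [h2, h1, Real.mul_rpow (by positivity) hA.le, ← Real.rpow_mul ht0.le,
        mul_one_div_cancel hp0.ne', Real.rpow_one]
    have haG : a ≤ t * C * ((lam * E + 1) ^ q - (lam * E) ^ q) ^ (1 / q) := by
      rw [haA, mul_assoc]
      exact mul_le_mul_of_nonneg_left (hC E hE0) ht0.le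
    have key : a ^ q + (lam * (C * b)) ^ q ≤ (t * C * (lam * E + 1)) ^ q := by
      have h1 := Real.rpow_le_rpow ha haG hq0.le
      rw [Real.mul_rpow (by positivity) (by positivity), ← Real.rpow_mul hG.le,
        one_div_mul_cancel hq0.ne', Real.rpow_one] at h1
      have h2 : lam * (C * b) = t * C * (lam * E) := by rw [hb']; ring
      rw [h2, Real.mul_rpow (x := t * C) (by positivity) hV,
        Real.mul_rpow (x := t * C) (by positivity) (by positivity)]
      linarith
    have key' : (a ^ q + (lam * (C * b)) ^ q) ^ (1 / q) ≤ t * C * (lam * E + 1) := by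
      refine (Real.rpow_le_rpow (by positivity) key (by positivity)).trans_eq ?_
      rw [← Real.rpow_mul (by positivity), mul_one_div_cancel hq0.ne', Real.rpow_one]
    rw [hc']
    rw [hb'] at key' ⊢
    linarith

theorem thin_geom {lam E : ℝ} (hlam0 : 0 ≤ lam) (hlam1 : lam ≤ 1) (hE : 0 ≤ E) (n : ℕ) :
    HasSum (fun k : ℕ => (k.choose n : ℝ) * lam ^ n * (1 - lam) ^ (k - n) * geom E k)
      (geom (lam * E) n) := by
  have hE1 : 0 < E + 1 := by linarith
  have hl1 : 0 < lam * E + 1 := by positivity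
  have hr : ‖(1 - lam) * (E / (E + 1))‖ < 1 := by
    rw [Real.norm_of_nonneg (mul_nonneg (by linarith) (by positivity)), ← mul_div_assoc,
      div_lt_one hE1]
    nlinarith [mul_nonneg hlam0 hE]
  rw [← hasSum_nat_add_iff' n, Finset.sum_eq_zero, sub_zero]
  · convert (hasSum_choose_mul_geometric_of_norm_lt_one n hr).mul_left
      (lam ^ n * (1 / (E + 1)) * (E / (E + 1)) ^ n) using 1
    · rfl
    · funext k
      simp only [geom, Nat.add_sub_cancel, mul_pow, pow_add]
      ring
    · have : 1 - (1 - lam) * (E / (E + 1)) = (lam * E + 1) / (E + 1) := by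
        field_simp
        ring
      rw [this]
      simp only [geom, div_pow, mul_pow, pow_succ]
      field_simp
  · intro k hk
    simp [Nat.choose_eq_zero_of_lt (Finset.mem_range.1 hk)]

theorem lnorm_geom {s E : ℝ} (hs : 1 ≤ s) (hE : 0 ≤ E) :
    lnorm s (geom E) = ENNReal.ofReal (1 / ((E + 1) ^ s - E ^ s) ^ (1 / s)) := by
  have hs0 : 0 < s := by linarith
  have hE1 : 0 < E + 1 := by linarith
  have hpos := rpow_sub_rpow_pos hs hE
  have hterm : ∀ n, |geom E n| ^ s = (1 / (E + 1)) ^ s * ((E / (E + 1)) ^ s) ^ n := by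
    intro n
    rw [geom, abs_of_nonneg (by positivity), Real.mul_rpow (by positivity) (by positivity),
      Real.rpow_pow_comm (by positivity)]
  have hr : (E / (E + 1)) ^ s < 1 :=
    Real.rpow_lt_one (by positivity) ((div_lt_one hE1).2 (by linarith)) hs0
  have hsum := (hasSum_geometric_of_lt_one (by positivity) hr).mul_left ((1 / (E + 1)) ^ s)
  have hval : (1 / (E + 1)) ^ s * (1 - (E / (E + 1)) ^ s)⁻¹ = 1 / ((E + 1) ^ s - E ^ s) := by
    have : 0 < (E + 1) ^ s := by positivity
    rw [Real.div_rpow zero_le_one hE1.le, Real.div_rpow hE hE1.le, Real.one_rpow]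
    field_simp
  simp only [lnorm, hterm]
  rw [← ENNReal.ofReal_tsum_of_nonneg (fun n => by positivity) hsum.summable, hsum.tsum_eq, hval,
    ENNReal.ofReal_rpow_of_nonneg (by positivity) (by positivity),
    Real.div_rpow zero_le_one hpos.le, Real.one_rpow]

/-- The `p → q` norms of the thinning are achieved by geometric distributions: the
supremum of `‖T_λ(x)‖_q / ‖x‖_p` over all admissible `x` with `0 < ‖x‖_p < ∞` equals the
supremum over `E ≥ 0` of `‖T_λ(ω(E))‖_q / ‖ω(E)‖_p`, as an equality in `[0,∞]`. -/
theorem thinning_norms_geom (lam : ℝ) (hlam0 : 0 ≤ lam) (hlam1 : lam ≤ 1)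
    (p q : ℝ) (hp : 1 ≤ p) (hq : 1 ≤ q) :
    (⨆ x ∈ {x : ℕ → ℝ | lnorm p x ≠ 0 ∧ lnorm p x ≠ ∞ ∧ ThinSummable lam x},
        lnorm q (thin lam x) / lnorm p x) =
      ⨆ (E : ℝ) (_ : 0 ≤ E), lnorm q (thin lam (geom E)) / lnorm p (geom E) := by
  have hp0 : 0 < p := by linarith
  have hq0 : 0 < q := by linarith
  have hthin : ∀ E : ℝ, 0 ≤ E → thin lam (geom E) = geom (lam * E) := fun E hE =>
    funext fun n => (thin_geom hlam0 hlam1 hE n).tsum_eq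
  apply le_antisymm
  · refine iSup₂_le fun x hx => ?_
    obtain ⟨hx0, hxtop, -⟩ := hx
    rw [ENNReal.div_le_iff hx0 hxtop]
    set S := ⨆ (E : ℝ) (_ : 0 ≤ E), lnorm q (thin lam (geom E)) / lnorm p (geom E)
    rcases eq_or_ne S ∞ with hS_top | hS_top
    · rw [hS_top, ENNReal.top_mul hx0]
      exact le_top
    obtain ⟨C, hC0, hCS⟩ : ∃ C : ℝ, 0 ≤ C ∧ S = ENNReal.ofReal C :=
      ⟨S.toReal, ENNReal.toReal_nonneg, (ENNReal.ofReal_toReal hS_top).symm⟩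
    have hC : ∀ E : ℝ, 0 ≤ E → ((E + 1) ^ p - E ^ p) ^ (1 / p) ≤
        C * ((lam * E + 1) ^ q - (lam * E) ^ q) ^ (1 / q) := by
      intro E hE
      have hA := Real.rpow_pos_of_pos (rpow_sub_rpow_pos hp hE) (1 / p)
      have hG := Real.rpow_pos_of_pos
        (rpow_sub_rpow_pos hq (mul_nonneg hlam0 hE)) (1 / q)
      have h : lnorm q (thin lam (geom E)) / lnorm p (geom E) ≤ S :=
        le_iSup₂ (f := fun (E : ℝ) (_ : 0 ≤ E) =>
          lnorm q (thin lam (geom E)) / lnorm p (geom E)) E hE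
      rw [hthin E hE, lnorm_geom hq (mul_nonneg hlam0 hE), lnorm_geom hp hE, hCS,
        ← ENNReal.ofReal_div_of_pos (by positivity), ENNReal.ofReal_le_ofReal_iff hC0,
        div_div_eq_mul_div, div_one, one_div_mul_eq_div, div_le_iff₀ hG] at h
      exact h
    have hCpos : 0 < C := by
      rcases hC0.eq_or_lt with rfl | h
      · have := hC 0 le_rfl
        simp [Real.zero_rpow hp0.ne'] at this
        linarith
      · exact h
    have hstep : ∀ a b c : ℝ≥0∞, a ^ p + b ^ p = c ^ p →
        ‖1 - lam‖ₑ * (S * b) + (a ^ q + (‖lam‖ₑ * (S * b)) ^ q) ^ (1 / q) ≤ S * c := by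
      intro a b c habc
      rcases eq_or_ne c ∞ with rfl | hc
      · rw [ENNReal.mul_top (by rw [hCS]; exact (ENNReal.ofReal_pos.2 hCpos).ne')]
        exact le_top
      have hcp : c ^ p ≠ ∞ := ENNReal.rpow_ne_top_of_nonneg hp0.le hc
      rw [← habc, ENNReal.add_ne_top] at hcp
      lift a to NNReal using fun h => hcp.1 (by rw [h, ENNReal.top_rpow_of_pos hp0])
      lift b to NNReal using fun h => hcp.2 (by rw [h, ENNReal.top_rpow_of_pos hp0])
      lift c to NNReal using hc
      have habc' : (a : ℝ) ^ p + (b : ℝ) ^ p = (c : ℝ) ^ p := by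
        rw [← ENNReal.coe_rpow_of_nonneg _ hp0.le, ← ENNReal.coe_rpow_of_nonneg _ hp0.le,
          ← ENNReal.coe_rpow_of_nonneg _ hp0.le] at habc
        exact_mod_cast habc
      have h := thinning_step_le hlam0 hp hq hC0 a.2 b.2 c.2 habc' hC
      have hlam1' : 0 ≤ 1 - lam := by linarith
      rw [hCS, Real.enorm_of_nonneg hlam0, Real.enorm_of_nonneg hlam1',
        ← ENNReal.ofReal_coe_nnreal (p := a), ← ENNReal.ofReal_coe_nnreal (p := b),
        ← ENNReal.ofReal_coe_nnreal (p := c), ← ENNReal.ofReal_mul hC0,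
        ← ENNReal.ofReal_mul hlam1', ← ENNReal.ofReal_mul hlam0, ← ENNReal.ofReal_mul hC0,
        ENNReal.ofReal_rpow_of_nonneg (by positivity) hq0.le,
        ENNReal.ofReal_rpow_of_nonneg (by positivity) hq0.le,
        ← ENNReal.ofReal_add (by positivity) (by positivity),
        ENNReal.ofReal_rpow_of_nonneg (by positivity) (by positivity),
        ← ENNReal.ofReal_add (by positivity) (by positivity)]
      exact ENNReal.ofReal_le_ofReal h
    rw [lnorm_eq_ennLpNorm hp0.le, lnorm_eq_ennLpNorm hq0.le]
    exact (ennLpNorm_mono hq0 (enorm_thin_le lam x)).trans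
      (ennLpNorm_ennThin_le_mul hp hq hstep _)
  · refine iSup₂_le fun E hE => ?_
    have hA := Real.rpow_pos_of_pos (rpow_sub_rpow_pos hp hE) (1 / p)
    refine le_iSup₂ (f := fun (x : ℕ → ℝ)
      (_ : x ∈ {x : ℕ → ℝ | lnorm p x ≠ 0 ∧ lnorm p x ≠ ∞ ∧ ThinSummable lam x}) =>
        lnorm q (thin lam x) / lnorm p x) (geom E) ⟨?_, ?_, fun n => ?_⟩
    · rw [lnorm_geom hp hE]
      exact (ENNReal.ofReal_pos.2 (by positivity)).ne'
    · rw [lnorm_geom hp hE]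
      exact ENNReal.ofReal_ne_top
    · have habs : ∀ k, |geom E k| = geom E k := fun k =>
        abs_of_nonneg (by unfold geom; positivity)
      simp only [habs]
      exact (thin_geom hlam0 hlam1 hE n).summable
end
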